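/- Let E be a complex Banach space. Let U₀ : ℝ × ℝ → (E →L[ℂ] E) be such that (t, s) ↦ U₀(t, s) x is continuous for every x ∈ E, U₀(t, t) = id for all t, and U₀(t, s) ∘ U₀(s, r) = U₀(t, r) for all t, s, r ∈ ℝ. Let H : ℕ → ℝ → (E →L[ℂ] E) be such that s ↦ H_m(s) x is continuous for every m ≥ 1 and x ∈ E, and define H̃_m(s, t) := U₀(t, s) ∘ H_m(s) ∘ U₀(s, t). Let r ∈ ℕ and let χ_0, …, χ_r : ℝ → E be continuous functions satisfying, for every ℓ ∈ {0, …, r} and every t ∈ ℝ, the Duhamel recursion χ_ℓ(t) = U₀(t, 0) χ_ℓ(0) − i ∑_{m=0}^{ℓ−1} ∫_0^t U₀(t, s) (H_{ℓ−m}(s) (χ_m(s))) ds. Then for every ℓ ∈ {0, …, r} and t ∈ ℝ one has χ_ℓ(t) = U₀(t, 0) χ_ℓ(0) + ∑_{m=0}^{ℓ−1} ∑_{k=1}^{ℓ−m} ∑_{α ∈ (ℕ_{≥1})^k, α₁+⋯+α_k = ℓ−m} (−i)^k ∫_0^t ∫_0^{s₁} ⋯ ∫_0^{s_{k−1}} H̃_{α₁}(s₁,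 t)( H̃_{α₂}(s₂, t)( ⋯ H̃_{α_k}(s_k, t)( U₀(t, 0) χ_m(0) ) ⋯ )) ds_k ⋯ ds₂ ds₁. -/

import Mathlib

open MeasureTheory Finset

/-- Iterated time-ordered (simplex) integral: for `α = [a₁, …, a_k]`,
`simplexIntegral G α u v = ∫_0^u ds₁ G a₁ s₁ (∫_0^{s₁} ds₂ G a₂ s₂ ( ⋯ v ⋯ ))`,
i.e. the iterated Bochner integral over the simplex `0 ≤ s_k ≤ ⋯ ≤ s₁ ≤ u` of the
composition `G a₁ s₁ ∘ ⋯ ∘ G a_k s_k` applied to `v`. -/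
noncomputable def simplexIntegral {E : Type*} [NormedAddCommGroup E] [NormedSpace ℂ E]
    (G : ℕ → ℝ → E →L[ℂ] E) : List ℕ → ℝ → E → E
  | [], _, v => v
  | a :: l, u, v => ∫ s in (0 : ℝ)..u, G a s (simplexIntegral G l s v)

/-- A strongly continuous family of operators, applied to a continuous curve, is continuous. -/
theorem continuous_clm_apply_of_strongly_continuous {E F : Type*}
    [NormedAddCommGroup E] [NormedSpace ℂ E] [CompleteSpace E]
    [NormedAddCommGroup F] [NormedSpace ℂ F]
    {A : ℝ → E →L[ℂ] F} (hA : ∀ x, Continuous fun s => A s x)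
    {f : ℝ → E} (hf : Continuous f) : Continuous fun s => A s (f s) := by
  rw [continuous_iff_continuousAt]
  intro s₀
  obtain ⟨C, hC⟩ := banach_steinhaus (g := fun s : Metric.closedBall s₀ 1 => A s) fun x => by
    obtain ⟨C, hC⟩ := (isCompact_closedBall s₀ 1).exists_bound_of_continuousOn (hA x).continuousOn
    exact ⟨C, fun s => hC s s.2⟩
  have hlim : Filter.Tendsto (fun s => C * ‖f s - f s₀‖ + ‖A s (f s₀) - A s₀ (f s₀)‖)
      (nhds s₀) (nhds 0) := by
    have hcont : Continuous fun s => C * ‖f s - f s₀‖ + ‖A s (f s₀) - A s₀ (f s₀)‖ := by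
      have := hA (f s₀)
      fun_prop
    simpa using hcont.tendsto s₀
  refine tendsto_iff_norm_sub_tendsto_zero.2
    (squeeze_zero' (.of_forall fun _ => norm_nonneg _) ?_ hlim)
  filter_upwards [Metric.closedBall_mem_nhds s₀ one_pos] with s hs
  calc ‖A s (f s) - A s₀ (f s₀)‖ = ‖A s (f s - f s₀) + (A s (f s₀) - A s₀ (f s₀))‖ := by
        rw [map_sub]; abel_nf
    _ ≤ ‖A s (f s - f s₀)‖ + ‖A s (f s₀) - A s₀ (f s₀)‖ := norm_add_le _ _
    _ ≤ C * ‖f s - f s₀‖ + ‖A s (f s₀) - A s₀ (f s₀)‖ := by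
        gcongr
        exact (A s).le_of_opNorm_le (hC ⟨s, hs⟩) _

/-- The `k`-tuples of positive integers with sum `n`. -/
def positiveTuples (n k : ℕ) : Finset (Fin k → ℕ) :=
  (Fintype.piFinset fun _ : Fin k => Finset.Icc 1 n).filter fun α => ∑ i, α i = n

theorem mem_positiveTuples {n k : ℕ} {α : Fin k → ℕ} :
    α ∈ positiveTuples n k ↔ (∀ i, 1 ≤ α i) ∧ ∑ i, α i = n := by
  simp only [positiveTuples, mem_filter, Fintype.mem_piFinset, mem_Icc]
  refine ⟨fun h => ⟨fun i => (h.1 i).1, h.2⟩, fun h => ⟨fun i => ⟨h.1 i, ?_⟩, h.2⟩⟩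
  exact h.2 ▸ single_le_sum (fun _ _ => Nat.zero_le _) (mem_univ i)

theorem positiveTuples_eq_empty {n k : ℕ} (h : n < k) : positiveTuples n k = ∅ := by
  refine eq_empty_of_forall_notMem fun α hα => ?_
  obtain ⟨h1, h2⟩ := mem_positiveTuples.1 hα
  have := card_nsmul_le_sum univ α 1 fun i _ => h1 i
  simp only [card_univ, Fintype.card_fin, smul_eq_mul, mul_one, h2] at this
  omega

theorem sum_positiveTuples_succ {M : Type*} [AddCommMonoid M] (n k : ℕ)
    (f : (Fin (k + 1) → ℕ) → M) :
    ∑ α ∈ positiveTuples n (k + 1), f α =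
      ∑ a ∈ Icc 1 n, ∑ β ∈ positiveTuples (n - a) k, f (Fin.cons a β) := by
  rw [sum_sigma']
  refine sum_bij' (fun α _ => ⟨α 0, Fin.tail α⟩) (fun p _ => Fin.cons p.1 p.2) ?_ ?_ ?_ ?_ ?_
  · intro α hα
    simp only [mem_positiveTuples, Fin.sum_univ_succ, mem_sigma, mem_Icc, Fin.tail] at hα ⊢
    exact ⟨⟨hα.1 0, by omega⟩, fun i => hα.1 _, by omega⟩
  · rintro ⟨a, β⟩ hp
    simp only [mem_positiveTuples, Fin.sum_univ_succ, mem_sigma, mem_Icc, Fin.forall_fin_succ,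
      Fin.cons_zero, Fin.cons_succ] at hp ⊢
    exact ⟨⟨hp.1.1, hp.2.1⟩, by omega⟩
  · intro α _
    simp
  · intro p _
    simp
  · intro α _
    simp

section DysonSeries

variable {E : Type*} [NormedAddCommGroup E] [NormedSpace ℂ E]

/-- The `k`-fold time-ordered integrals of total order `n` in the Dyson expansion. -/
noncomputable def dysonTerm (G : ℕ → ℝ → E →L[ℂ] E) (n k : ℕ) (u : ℝ) (v : E) : E :=
  ∑ α ∈ positiveTuples n k, (-Complex.I) ^ k • simplexIntegral G (List.ofFn α) u v

/-- The part of total order `n` of the Dyson expansion. -/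
noncomputable def dysonSum (G : ℕ → ℝ → E →L[ℂ] E) (n : ℕ) (u : ℝ) (v : E) : E :=
  ∑ k ∈ range (n + 1), dysonTerm G n k u v

variable {G : ℕ → ℝ → E →L[ℂ] E}

theorem sum_range_dysonTerm {n K : ℕ} (h : n < K) (u : ℝ) (v : E) :
    ∑ k ∈ range K, dysonTerm G n k u v = dysonSum G n u v := by
  refine (sum_subset (range_subset_range.2 h) fun k _ hk => ?_).symm
  rw [dysonTerm, positiveTuples_eq_empty (by simpa using hk), sum_empty]

theorem dysonTerm_zero_right {n : ℕ} (hn : n ≠ 0) (u : ℝ) (v : E) : dysonTerm G n 0 u v = 0 := by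
  have : positiveTuples n 0 = ∅ := eq_empty_of_forall_notMem fun α hα => hn <| by
    simpa using (mem_positiveTuples.1 hα).2.symm
  rw [dysonTerm, this, sum_empty]

theorem dysonSum_zero (u : ℝ) (v : E) : dysonSum G 0 u v = v := by
  have : positiveTuples 0 0 = univ := eq_univ_of_forall fun α => by simp [mem_positiveTuples]
  simp [dysonSum, dysonTerm, this, simplexIntegral]

theorem dysonSum_eq_sum_Icc {n : ℕ} (hn : n ≠ 0) (u : ℝ) (v : E) :
    dysonSum G n u v = ∑ k ∈ Icc 1 n, dysonTerm G n k u v := by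
  rw [dysonSum, sum_range_succ', dysonTerm_zero_right hn, add_zero, range_eq_Ico,
    sum_Ico_add' (fun k => dysonTerm G n k u v)]
  rfl

variable [CompleteSpace E] (hG : ∀ a, 1 ≤ a → ∀ x, Continuous fun s => G a s x)
include hG

theorem continuous_simplexIntegral (l : List ℕ) (hl : ∀ a ∈ l, 1 ≤ a) (v : E) :
    Continuous fun u => simplexIntegral G l u v := by
  induction l with
  | nil => exact continuous_const
  | cons a l ih =>
    have hint := continuous_clm_apply_of_strongly_continuous (hG a (hl a (by simp)))
      (ih fun b hb => hl b (by simp [hb]))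
    exact intervalIntegral.continuous_primitive (fun _ _ => hint.intervalIntegrable _ _) 0

theorem continuous_simplexIntegral_ofFn {n k : ℕ} {α : Fin k → ℕ} (hα : α ∈ positiveTuples n k)
    (v : E) : Continuous fun u => simplexIntegral G (List.ofFn α) u v := by
  refine continuous_simplexIntegral hG _ (fun a ha => ?_) v
  obtain ⟨i, rfl⟩ := (List.mem_ofFn' α a).1 ha
  exact (mem_positiveTuples.1 hα).1 i

theorem continuous_dysonTerm (n k : ℕ) (v : E) : Continuous fun u => dysonTerm G n k u v :=
  continuous_finsetSum _ fun _ hα => (continuous_simplexIntegral_ofFn hG hα v).const_smul _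

theorem continuous_dysonSum (n : ℕ) (v : E) : Continuous fun u => dysonSum G n u v :=
  continuous_finsetSum _ fun k _ => continuous_dysonTerm hG n k v

theorem integral_clm_apply_sum {ι : Type*} {a : ℕ} (ha : 1 ≤ a) (S : Finset ι) {f : ι → ℝ → E}
    (hf : ∀ i ∈ S, Continuous (f i)) (u : ℝ) :
    ∫ s in (0 : ℝ)..u, G a s (∑ i ∈ S, f i s) = ∑ i ∈ S, ∫ s in (0 : ℝ)..u, G a s (f i s) := by
  simp only [map_sum]
  exact intervalIntegral.integral_finsetSum fun i hi =>
    (continuous_clm_apply_of_strongly_continuous (hG a ha) (hf i hi)).intervalIntegrable _ _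

theorem dysonTerm_succ (n k : ℕ) (u : ℝ) (v : E) :
    dysonTerm G n (k + 1) u v =
      ∑ a ∈ Icc 1 n, -Complex.I • ∫ s in (0 : ℝ)..u, G a s (dysonTerm G (n - a) k s v) := by
  rw [dysonTerm, sum_positiveTuples_succ]
  refine sum_congr rfl fun a ha => ?_
  unfold dysonTerm
  rw [integral_clm_apply_sum hG (mem_Icc.1 ha).1 _
    (f := fun β s => (-Complex.I) ^ k • simplexIntegral G (List.ofFn β) s v)
    fun β hβ => (continuous_simplexIntegral_ofFn hG hβ v).const_smul _, smul_sum]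
  refine sum_congr rfl fun β _ => ?_
  simp only [List.ofFn_cons, simplexIntegral, map_smul, intervalIntegral.integral_smul, smul_smul,
    pow_succ']

theorem dysonSum_eq_sum_integral {n : ℕ} (hn : n ≠ 0) (u : ℝ) (v : E) :
    dysonSum G n u v =
      ∑ a ∈ Icc 1 n, -Complex.I • ∫ s in (0 : ℝ)..u, G a s (dysonSum G (n - a) s v) := by
  rw [dysonSum, sum_range_succ', dysonTerm_zero_right hn, add_zero]
  simp only [dysonTerm_succ hG]
  rw [sum_comm]
  refine sum_congr rfl fun a ha => ?_
  rw [mem_Icc] at ha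
  rw [← smul_sum, ← integral_clm_apply_sum hG ha.1 _ fun k _ => continuous_dysonTerm hG _ k v]
  simp only [sum_range_dysonTerm (show n - a < n by omega)]

/-- Iterating a triangular system of Volterra equations yields its Dyson expansion. -/
theorem eq_sum_dysonSum {r : ℕ} {φ : ℕ → ℝ → E} {v : ℕ → E}
    (hφ : ∀ ℓ ≤ r, ∀ u, φ ℓ u = v ℓ - Complex.I •
      ∑ m ∈ range ℓ, ∫ s in (0 : ℝ)..u, G (ℓ - m) s (φ m s))
    {ℓ : ℕ} (hℓ : ℓ ≤ r) (u : ℝ) :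
    φ ℓ u = v ℓ + ∑ m ∈ range ℓ, dysonSum G (ℓ - m) u (v m) := by
  induction ℓ using Nat.strong_induction_on generalizing u with
  | _ ℓ ih =>
    rw [hφ ℓ hℓ u, sub_eq_add_neg, ← neg_smul, smul_sum]
    congr 1
    have hinner : ∀ p ∈ range ℓ, -Complex.I • ∫ s in (0 : ℝ)..u, G (ℓ - p) s (φ p s) =
        ∑ m ∈ range (p + 1),
          -Complex.I • ∫ s in (0 : ℝ)..u, G (ℓ - p) s (dysonSum G (p - m) s (v m)) := by
      intro p hp
      rw [mem_range] at hp
      rw [← smul_sum, ← integral_clm_apply_sum hG (by omega) _ fun m _ =>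
        continuous_dysonSum hG _ (v m)]
      congr 2
      funext s
      rw [ih p hp (by omega), sum_range_succ, Nat.sub_self, dysonSum_zero, add_comm]
    rw [sum_congr rfl hinner, sum_congr rfl fun m hm => dysonSum_eq_sum_integral hG
      (Nat.sub_ne_zero_of_lt (mem_range.1 hm)) u (v m), sum_sigma', sum_sigma']
    refine sum_bij' (fun p _ => ⟨p.2, ℓ - p.1⟩) (fun p _ => ⟨ℓ - p.2, p.1⟩) ?_ ?_ ?_ ?_ ?_
    all_goals
      rintro ⟨p, m⟩ h
      simp only [mem_sigma, mem_range, mem_Icc] at h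
    · simp only [mem_sigma, mem_range, mem_Icc]; omega
    · simp only [mem_sigma, mem_range]; omega
    · simp only [Sigma.mk.injEq, heq_eq_eq, and_true]; omega
    · simp only [Sigma.mk.injEq, heq_eq_eq, true_and]; omega
    · rw [show ℓ - m - (ℓ - p) = p - m by omega]

end DysonSeries

theorem duhamel_expansion {E : Type*} [NormedAddCommGroup E] [NormedSpace ℂ E] [CompleteSpace E]
    (U₀ : ℝ → ℝ → E →L[ℂ] E)
    (hU₀cont : ∀ x : E, Continuous fun p : ℝ × ℝ => U₀ p.1 p.2 x)
    (hU₀id : ∀ t : ℝ, U₀ t t = ContinuousLinearMap.id ℂ E)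
    (hU₀comp : ∀ t s r : ℝ, (U₀ t s).comp (U₀ s r) = U₀ t r)
    (H : ℕ → ℝ → E →L[ℂ] E)
    (hHcont : ∀ m : ℕ, 1 ≤ m → ∀ x : E, Continuous fun s : ℝ => H m s x)
    (r : ℕ) (χ : ℕ → ℝ → E)
    (hχcont : ∀ ℓ ≤ r, Continuous (χ ℓ))
    (hrec : ∀ ℓ ≤ r, ∀ t : ℝ,
      χ ℓ t = U₀ t 0 (χ ℓ 0) -
        Complex.I • ∑ m ∈ Finset.range ℓ,
          ∫ s in (0 : ℝ)..t, U₀ t s (H (ℓ - m) s (χ m s))) :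
    ∀ ℓ ≤ r, ∀ t : ℝ,
      χ ℓ t = U₀ t 0 (χ ℓ 0) +
        ∑ m ∈ Finset.range ℓ, ∑ k ∈ Finset.Icc 1 (ℓ - m),
          ∑ α ∈ (Fintype.piFinset fun _ : Fin k => Finset.Icc 1 (ℓ - m)).filter
              (fun α => ∑ i, α i = ℓ - m),
            ((-Complex.I) ^ k) •
              simplexIntegral (fun a s => (U₀ t s).comp ((H a s).comp (U₀ s t)))
                (List.ofFn α) t (U₀ t 0 (χ m 0)) := by
  intro ℓ hℓ t
  have hcomp (a b c : ℝ) (x : E) : U₀ a b (U₀ b c x) = U₀ a c x :=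
    congrArg (fun A : E →L[ℂ] E => A x) (hU₀comp a b c)
  have hleft (x : E) : Continuous fun s => U₀ t s x :=
    (hU₀cont x).comp (Continuous.prodMk continuous_const continuous_id)
  have hright (x : E) : Continuous fun s => U₀ s t x :=
    (hU₀cont x).comp (Continuous.prodMk continuous_id continuous_const)
  set G : ℕ → ℝ → E →L[ℂ] E := fun a s => (U₀ t s).comp ((H a s).comp (U₀ s t)) with hGdef
  have hG (a : ℕ) (ha : 1 ≤ a) (x : E) : Continuous fun s => G a s x :=
    continuous_clm_apply_of_strongly_continuous hleft
      (continuous_clm_apply_of_strongly_continuous (hHcont a ha) (hright x))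
  have hφ : ∀ ℓ ≤ r, ∀ u, U₀ t u (χ ℓ u) = U₀ t 0 (χ ℓ 0) - Complex.I •
      ∑ m ∈ range ℓ, ∫ s in (0 : ℝ)..u, G (ℓ - m) s (U₀ t s (χ m s)) := by
    intro ℓ hℓ u
    rw [hrec ℓ hℓ u, map_sub, map_smul, map_sum, hcomp]
    congr 2
    refine sum_congr rfl fun m hm => ?_
    rw [mem_range] at hm
    have hcont : Continuous fun s => U₀ u s (H (ℓ - m) s (χ m s)) :=
      continuous_clm_apply_of_strongly_continuous
        (fun x => (hU₀cont x).comp (Continuous.prodMk continuous_const continuous_id))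
        (continuous_clm_apply_of_strongly_continuous (hHcont _ (by omega)) (hχcont m (by omega)))
    rw [← ContinuousLinearMap.intervalIntegral_comp_comm _ (hcont.intervalIntegrable _ _)]
    simp [hGdef, hcomp, hU₀id]
  have key := eq_sum_dysonSum hG hφ hℓ t
  rw [hU₀id, ContinuousLinearMap.id_apply] at key
  rw [key]
  congr 1
  refine sum_congr rfl fun m hm => ?_
  exact dysonSum_eq_sum_Icc (Nat.sub_ne_zero_of_lt (mem_range.1 hm)) t _
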